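/- For each 2-cocycle f = f₁∘p₁ + f₂∘p₂ + f₃∘p₃ on g with values in z, there exists a decomposition f₁ = f₁⁰ + f₁¹ such that: f₁⁰∘p₁ vanishes on g × g' (equivalently, f̃₁⁰(a,b)(x,y) = 0 for all a,b ∈ A, x ∈ k, y ∈ k'); im(f̃₁¹) ⊆ Sym²(k,z)^k; and f₁¹ vanishes on T₀(A) ⊗ S²(k). Moreover f₁⁰∘p₁ and f₁¹∘p₁ + f₂∘p₂ + f₃∘p₃ are then themselves 2-cocycles. -/

import Mathlib

set_option linter.unusedSectionVars false
set_option synthInstance.maxHeartbeats 1000000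
set_option maxHeartbeats 1000000
open scoped TensorProduct

namespace CurrentPaper

variable (K : Type*) [Field K] [CharZero K]

section Wedge

variable (V : Type*) [AddCommGroup V] [Module K V]

/-- `x ∧ y = (1/2)(x ⊗ y - y ⊗ x)` inside `V ⊗ V`. -/
noncomputable def wedge (x y : V) : V ⊗[K] V := (2 : K)⁻¹ • (x ⊗ₜ[K] y - y ⊗ₜ[K] x)

/-- `x ∨ y = (1/2)(x ⊗ y + y ⊗ x)` inside `V ⊗ V`. -/
noncomputable def vee (x y : V) : V ⊗[K] V := (2 : K)⁻¹ • (x ⊗ₜ[K] y + y ⊗ₜ[K] x)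

/-- `Λ²(V)` realized as the subspace of skew-symmetric tensors of `V ⊗ V`. -/
def lambda2 : Submodule K (V ⊗[K] V) := Submodule.span K {t | ∃ x y : V, t = wedge K V x y}

/-- `S²(V)` realized as the subspace of symmetric tensors of `V ⊗ V`. -/
def sym2 : Submodule K (V ⊗[K] V) := Submodule.span K {t | ∃ x y : V, t = vee K V x y}

variable {V}

lemma wedge_mem (x y : V) : wedge K V x y ∈ lambda2 K V := Submodule.subset_span ⟨x, y, rfl⟩

lemma vee_mem (x y : V) : vee K V x y ∈ sym2 K V := Submodule.subset_span ⟨x, y, rfl⟩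

end Wedge

section LieRelaxed

variable (L : Type*) [LieRing L] [Module K L]

/-- `∂(u ∧ v ∧ w) = ⁅u,v⁆ ∧ w + ⁅v,w⁆ ∧ u + ⁅w,u⁆ ∧ v`. -/
noncomputable def dd (u v w : L) : L ⊗[K] L :=
  wedge K L ⁅u, v⁆ w + wedge K L ⁅v, w⁆ u + wedge K L ⁅w, u⁆ v

/-- `B₂(L)`, the space of 2-boundaries, i.e. the image of `∂ : Λ³(L) → Λ²(L)`. -/
def B2 : Submodule K (L ⊗[K] L) := Submodule.span K {t | ∃ u v w : L, t = dd K L u v w}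

variable {L}

lemma dd_mem_lambda2 (u v w : L) : dd K L u v w ∈ lambda2 K L :=
  add_mem (add_mem (wedge_mem K _ _) (wedge_mem K _ _)) (wedge_mem K _ _)

lemma dd_mem_B2 (u v w : L) : dd K L u v w ∈ B2 K L := Submodule.subset_span ⟨u, v, w, rfl⟩

end LieRelaxed

section Lie

variable (L : Type*) [LieRing L] [LieAlgebra K L]

/-- The bracket `b : L ⊗ L → L`, `u ⊗ v ↦ ⁅u,v⁆`, as a linear map. -/
noncomputable def bracketHom : L ⊗[K] L →ₗ[K] L :=
  TensorProduct.lift (LinearMap.mk₂ K (fun u v => ⁅u, v⁆) add_lie smul_lie lie_add lie_smul)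

/-- `Z₂(L) = Λ²(L) ∩ ker b`, the space of 2-cycles. -/
noncomputable def Z2 : Submodule K (L ⊗[K] L) := lambda2 K L ⊓ LinearMap.ker (bracketHom K L)

/-- The derived algebra `L' = [L,L]`, as a subspace of `L`. -/
def derived : Submodule K L := Submodule.span K {m | ∃ u v : L, m = ⁅u, v⁆}

end Lie

section Alg

variable (A : Type*) [CommRing A] [Algebra K A]

/-- `I_A ⊆ S²(A)`: the kernel of the multiplication map `S²(A) → A`. -/
noncomputable def ia : Submodule K (A ⊗[K] A) := sym2 K A ⊓ LinearMap.ker (LinearMap.mul' K A)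

/-- `T(A) ⊆ Λ²(A)`: the span of the elements `ab ∧ c + bc ∧ a + ca ∧ b`. -/
def TA : Submodule K (A ⊗[K] A) :=
  Submodule.span K
    {t | ∃ a b c : A, t = wedge K A (a*b) c + wedge K A (b*c) a + wedge K A (c*a) b}

/-- `T₀(A) ⊆ Λ²(A)`: the span of the elements `ab ∧ c + bc ∧ a + ca ∧ b - abc ∧ 1`. -/
def T0A : Submodule K (A ⊗[K] A) :=
  Submodule.span K
    {t | ∃ a b c : A,
      t = wedge K A (a*b) c + wedge K A (b*c) a + wedge K A (c*a) b - wedge K A (a*b*c) 1}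

variable {A}

lemma TA_el_mem_lambda2 (a b c : A) :
    wedge K A (a*b) c + wedge K A (b*c) a + wedge K A (c*a) b ∈ lambda2 K A :=
  add_mem (add_mem (wedge_mem K _ _) (wedge_mem K _ _)) (wedge_mem K _ _)

lemma T0A_el_mem_lambda2 (a b c : A) :
    wedge K A (a*b) c + wedge K A (b*c) a + wedge K A (c*a) b - wedge K A (a*b*c) 1 ∈
      lambda2 K A :=
  sub_mem (TA_el_mem_lambda2 K a b c) (wedge_mem K _ _)

lemma ia_el_mem (a b : A) : vee K A a b - vee K A (a * b) 1 ∈ ia K A := by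
  refine Submodule.mem_inf.mpr ⟨sub_mem (vee_mem K a b) (vee_mem K _ _), ?_⟩
  simp only [LinearMap.mem_ker, map_sub, vee, map_smul, map_add, LinearMap.mul'_apply,
    mul_one, one_mul, mul_comm b a]
  simp

end Alg

section Current

variable (A : Type*) [CommRing A] [Algebra K A]
variable (k : Type*) [LieRing k] [LieAlgebra K k]

lemma g_smul_lie (c : K) (x y : A ⊗[K] k) : ⁅c • x, y⁆ = c • ⁅x, y⁆ := by
  rw [← algebraMap_smul A c x, ← algebraMap_smul A c ⁅x, y⁆, smul_lie]

lemma g_lie_smul (c : K) (x y : A ⊗[K] k) : ⁅x, c • y⁆ = c • ⁅x, y⁆ := by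
  rw [← algebraMap_smul A c y, ← algebraMap_smul A c ⁅x, y⁆, lie_smul]

/-- The bracket of the current algebra `g = A ⊗ k`, as a `K`-linear map `g ⊗ g → g`. -/
noncomputable def gBracket : (A ⊗[K] k) ⊗[K] (A ⊗[K] k) →ₗ[K] A ⊗[K] k :=
  TensorProduct.lift (LinearMap.mk₂ K (fun u v => ⁅u, v⁆) add_lie
    (fun c x y => g_smul_lie K A k c x y) lie_add (fun c x y => g_lie_smul K A k c x y))

/-- `Z₂(g) = Λ²(g) ∩ ker b` for the current algebra `g = A ⊗ k`. -/
noncomputable def Z2g : Submodule K ((A ⊗[K] k) ⊗[K] (A ⊗[K] k)) :=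
  lambda2 K (A ⊗[K] k) ⊓ LinearMap.ker (gBracket K A k)

/-- The first summand `Λ²(A) ⊗ S²(k)` of the decomposition of `Λ²(A ⊗ k)`. -/
abbrev M1 := (↥(lambda2 K A)) ⊗[K] (↥(sym2 K k))

/-- The second summand `A ⊗ Λ²(k)` of the decomposition of `Λ²(A ⊗ k)`. -/
abbrev M2 := A ⊗[K] (↥(lambda2 K k))

/-- The third summand `I_A ⊗ Λ²(k)` of the decomposition of `Λ²(A ⊗ k)`. -/
abbrev M3 := (↥(ia K A)) ⊗[K] (↥(lambda2 K k))

/-- The target of the isomorphism `P = (p₁,p₂,p₃)`. -/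
abbrev Wspace := M1 K A k × M2 K A k × M3 K A k

variable {A k}

/-- The property characterizing the linear isomorphism
`P = (p₁,p₂,p₃) : Λ²(A ⊗ k) ≅ (Λ²(A) ⊗ S²(k)) ⊕ (A ⊗ Λ²(k)) ⊕ (I_A ⊗ Λ²(k))`:
`p₁(ax ∧ by) = a ∧ b ⊗ x ∨ y`, `p₂(ax ∧ by) = ab ⊗ x ∧ y`,
`p₃(ax ∧ by) = (a ∨ b - ab ∨ 1) ⊗ x ∧ y`. -/
def IsDecomposition (P : ↥(lambda2 K (A ⊗[K] k)) ≃ₗ[K] Wspace K A k) : Prop :=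
  ∀ (a b : A) (x y : k),
    P ⟨wedge K (A ⊗[K] k) (a ⊗ₜ x) (b ⊗ₜ y), wedge_mem K _ _⟩ =
      ((⟨wedge K A a b, wedge_mem K a b⟩ ⊗ₜ[K] ⟨vee K k x y, vee_mem K x y⟩ : M1 K A k),
       ((a * b) ⊗ₜ[K] ⟨wedge K k x y, wedge_mem K x y⟩ : M2 K A k),
       ((⟨vee K A a b - vee K A (a * b) 1, ia_el_mem K a b⟩ ⊗ₜ[K]
          ⟨wedge K k x y, wedge_mem K x y⟩ : M3 K A k)))

end Current

end CurrentPaper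

namespace CurrentPaper

variable (K : Type*) [Field K] [CharZero K]
variable (A : Type*) [CommRing A] [Algebra K A]
variable (k : Type*) [LieRing k] [LieAlgebra K k]
variable (z : Type*) [AddCommGroup z] [Module K z]

/-- A `z`-valued linear map on `Λ²(g)` is a 2-cocycle iff it vanishes on `B₂(g)`. -/
def IsCocycle (F : ↥(lambda2 K (A ⊗[K] k)) → z) : Prop :=
  ∀ t : ↥(lambda2 K (A ⊗[K] k)),
    (t : (A ⊗[K] k) ⊗[K] (A ⊗[K] k)) ∈ B2 K (A ⊗[K] k) → F t = 0

section Helpers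

variable {K A k z}

/-- A linear map on a submodule that vanishes on generators `S` vanishes on the span of `S`. -/
lemma apply_eq_zero_of_mem_span {V : Type*} [AddCommGroup V] [Module K V] {M : Submodule K V}
    (F : M →ₗ[K] z) (S : Set V) (h : ∀ s ∈ S, ∃ hs : s ∈ M, F ⟨s, hs⟩ = 0) (t : M)
    (ht : (t : V) ∈ Submodule.span K S) : F t = 0 := by
  have hle : Submodule.span K S ≤ (LinearMap.ker F).map M.subtype := by
    refine Submodule.span_le.mpr fun s hs => ?_
    obtain ⟨hM, h0⟩ := h s hs
    exact ⟨⟨s, hM⟩, h0, rfl⟩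
  obtain ⟨t', h0, he⟩ := hle ht
  have : t' = t := Subtype.ext he
  rwa [this] at h0

/-- Every subspace is the range of a linear projection. -/
lemma exists_linearProjection {V : Type*} [AddCommGroup V] [Module K V] (p : Submodule K V) :
    ∃ e : V →ₗ[K] V, (∀ v, e v ∈ p) ∧ ∀ v ∈ p, e v = v := by
  obtain ⟨r, hr⟩ := p.subtype.exists_leftInverse_of_injective p.ker_subtype
  exact ⟨p.subtype ∘ₗ r, fun v => (r v).2,
    fun v hv => congrArg p.subtype (LinearMap.congr_fun hr ⟨v, hv⟩)⟩

variable (K) in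
/-- The bilinear map `(x, y) ↦ x ∧ y` with values in `Λ²(V)`. -/
noncomputable def wedgeHom (V : Type*) [AddCommGroup V] [Module K V] :
    V →ₗ[K] V →ₗ[K] lambda2 K V :=
  LinearMap.mk₂ K (fun x y => ⟨wedge K V x y, wedge_mem K x y⟩)
    (fun _ _ _ => Subtype.ext <| by
      simp only [wedge, TensorProduct.add_tmul, TensorProduct.tmul_add, Submodule.coe_add]; module)
    (fun _ _ _ => Subtype.ext <| by
      simp only [wedge, TensorProduct.tmul_smul, ← TensorProduct.smul_tmul', Submodule.coe_smul]
      module)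
    (fun _ _ _ => Subtype.ext <| by
      simp only [wedge, TensorProduct.add_tmul, TensorProduct.tmul_add, Submodule.coe_add]; module)
    (fun _ _ _ => Subtype.ext <| by
      simp only [wedge, TensorProduct.tmul_smul, ← TensorProduct.smul_tmul', Submodule.coe_smul]
      module)

variable (K) in
/-- The bilinear map `(x, y) ↦ x ∨ y` with values in `S²(V)`. -/
noncomputable def veeHom (V : Type*) [AddCommGroup V] [Module K V] :
    V →ₗ[K] V →ₗ[K] sym2 K V :=
  LinearMap.mk₂ K (fun x y => ⟨vee K V x y, vee_mem K x y⟩)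
    (fun _ _ _ => Subtype.ext <| by
      simp only [vee, TensorProduct.add_tmul, TensorProduct.tmul_add, Submodule.coe_add]; module)
    (fun _ _ _ => Subtype.ext <| by
      simp only [vee, TensorProduct.tmul_smul, ← TensorProduct.smul_tmul', Submodule.coe_smul]
      module)
    (fun _ _ _ => Subtype.ext <| by
      simp only [vee, TensorProduct.add_tmul, TensorProduct.tmul_add, Submodule.coe_add]; module)
    (fun _ _ _ => Subtype.ext <| by
      simp only [vee, TensorProduct.tmul_smul, ← TensorProduct.smul_tmul', Submodule.coe_smul]
      module)

lemma wedgeHom_swap {V : Type*} [AddCommGroup V] [Module K V] (x y : V) :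
    wedgeHom K V x y = -wedgeHom K V y x :=
  Subtype.ext <| by
    simp only [wedgeHom, LinearMap.mk₂_apply, wedge, NegMemClass.coe_neg]; module

lemma veeHom_swap {V : Type*} [AddCommGroup V] [Module K V] (x y : V) :
    veeHom K V x y = veeHom K V y x :=
  Subtype.ext <| by
    simp only [veeHom, LinearMap.mk₂_apply, vee, add_comm]

variable (K) in
/-- The element `a ∨ b - ab ∨ 1` of `I_A`. -/
noncomputable def iaMk (a b : A) : ia K A := ⟨vee K A a b - vee K A (a * b) 1, ia_el_mem K a b⟩

lemma iaMk_swap (a b : A) : iaMk K a b = iaMk K b a :=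
  Subtype.ext <| by simp only [iaMk, vee, mul_comm a b, add_comm (a ⊗ₜ[K] b)]

lemma iaMk_one_right (a : A) : iaMk K a 1 = 0 :=
  Subtype.ext <| by simp [iaMk]

/-- The consequences of the cocycle identity for the components of a cocycle: the component
`β` is invariant, and it satisfies the `T₀`-identity on brackets. -/
lemma invariant_and_T0_of_cocycle_identity
    (R : Type*) [Field R] [CharZero R] [Module R z]
    (β : A → A → k → k → z) (γ : A → k → k → z) (δ : A → A → k → k → z)
    (hskew : ∀ a b x y, β a b x y = -β b a x y) (hsymm : ∀ a b x y, β a b x y = β a b y x)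
    (hδ : ∀ a b x y, δ a b x y = δ b a x y) (hδ1 : ∀ a x y, δ a 1 x y = 0)
    (h : ∀ (a b c : A) (x y w : k),
      (β (a * b) c ⁅x, y⁆ w + γ (a * b * c) ⁅x, y⁆ w + δ (a * b) c ⁅x, y⁆ w) +
      (β (b * c) a ⁅y, w⁆ x + γ (b * c * a) ⁅y, w⁆ x + δ (b * c) a ⁅y, w⁆ x) +
      (β (c * a) b ⁅w, x⁆ y + γ (c * a * b) ⁅w, x⁆ y + δ (c * a) b ⁅w, x⁆ y) = 0) :
    (∀ (a b : A) (x y w : k), β a b ⁅x, y⁆ w = β a b x ⁅y, w⁆) ∧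
    (∀ (a b c : A) (x y w : k), β (a * b) c ⁅x, y⁆ w + β (b * c) a ⁅x, y⁆ w + β (c * a) b ⁅x, y⁆ w
      - β (a * b * c) 1 ⁅x, y⁆ w = 0) := by
  have hδ1' : ∀ a x y, δ 1 a x y = 0 := fun a x y => by rw [hδ, hδ1]
  have h1 : ∀ (a : A) (x y w : k), β a 1 ⁅x, y⁆ w - β a 1 ⁅y, w⁆ x + β a 1 ⁅w, x⁆ y +
      (γ a ⁅x, y⁆ w + γ a ⁅y, w⁆ x + γ a ⁅w, x⁆ y) = 0 := fun a x y w => by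
    have := h a 1 1 x y w
    simp only [mul_one, one_mul, hδ1, hδ1', hskew 1 a] at this
    linear_combination (norm := module) this
  have h2 : ∀ (a : A) (x y w : k), β a 1 ⁅x, y⁆ w + (γ a ⁅x, y⁆ w + γ a ⁅y, w⁆ x + γ a ⁅w, x⁆ y) = 0 :=
    fun a x y w => by
      linear_combination (norm := module) (1 / 2 : R) • h1 a x y w + (1 / 2 : R) • h1 a y w x
  have h3 : ∀ (a b : A) (x y w : k), -β a b ⁅y, w⁆ x + β a b ⁅w, x⁆ y + δ a b ⁅y, w⁆ x
      + δ a b ⁅w, x⁆ y = 0 := fun a b x y w => by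
    have := h a b 1 x y w
    simp only [mul_one, one_mul, hδ1, hskew b a, hδ b a, mul_comm b a] at this
    linear_combination (norm := module) this - h2 (a * b) x y w
  have h4 : ∀ (a b : A) (x y w : k), β a b ⁅y, w⁆ x = β a b ⁅w, x⁆ y := fun a b x y w => by
    have := h3 b a x y w
    rw [hskew b a, hskew b a, hδ b a, hδ b a] at this
    linear_combination (norm := module) (1 / 2 : R) • this - (1 / 2 : R) • h3 a b x y w
  have h5 : ∀ (a b : A) (x y w : k), δ a b ⁅y, w⁆ x = - δ a b ⁅w, x⁆ y := fun a b x y w => by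
    linear_combination (norm := module) h3 a b x y w + h4 a b x y w
  have h6 : ∀ (a b : A) (x y w : k), δ a b ⁅x, y⁆ w = 0 := fun a b x y w => by
    linear_combination (norm := module) (1 / 2 : R) • h5 a b w x y - (1 / 2 : R) • h5 a b x y w
      + (1 / 2 : R) • h5 a b y w x
  refine ⟨fun a b x y w => ?_, fun a b c x y w => ?_⟩
  · rw [hsymm a b x, h4 a b w x y]
  · have := h a b c x y w
    rw [show b * c * a = a * b * c by ring, show c * a * b = a * b * c by ring] at this
    simp only [h6] at this
    linear_combination (norm := module) this - h2 (a * b * c) x y w + h4 (b * c) a w x y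
      - h4 (c * a) b y w x

variable {F : lambda2 K (A ⊗[K] k) →ₗ[K] z}

/-- A linear map on `Λ²(g)` that kills `[ax, by] ∧ cw` for all pure tensors is a cocycle. -/
lemma isCocycle_of_apply_wedge_eq_zero
    (h : ∀ (a c : A) (x y w : k), F (wedgeHom K _ (a ⊗ₜ[K] ⁅x, y⁆) (c ⊗ₜ[K] w)) = 0) :
    IsCocycle K A k z F := by
  have key : ∀ u v w : A ⊗[K] k, F (wedgeHom K _ ⁅u, v⁆ w) = 0 := by
    intro u v w
    induction u using TensorProduct.induction_on with
    | zero => simp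
    | add u₁ u₂ h₁ h₂ => rw [add_lie, map_add, LinearMap.add_apply, map_add, h₁, h₂, add_zero]
    | tmul a x =>
      induction v using TensorProduct.induction_on with
      | zero => simp
      | add u₁ u₂ h₁ h₂ => rw [lie_add, map_add, LinearMap.add_apply, map_add, h₁, h₂, add_zero]
      | tmul b y =>
        induction w using TensorProduct.induction_on with
        | zero => simp
        | add u₁ u₂ h₁ h₂ => rw [map_add, map_add, h₁, h₂, add_zero]
        | tmul c w => rw [LieAlgebra.ExtendScalars.bracket_tmul, h]
  intro t ht
  refine apply_eq_zero_of_mem_span F _ ?_ t ht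
  rintro _ ⟨u, v, w, rfl⟩
  refine ⟨dd_mem_lambda2 K u v w, ?_⟩
  change F (wedgeHom K _ ⁅u, v⁆ w + wedgeHom K _ ⁅v, w⁆ u + wedgeHom K _ ⁅w, u⁆ v) = 0
  simp only [map_add, key, add_zero]

/-- The cocycle identity on pure tensors. -/
lemma IsCocycle.identity (hF : IsCocycle K A k z F) (a b c : A) (x y w : k) :
    F (wedgeHom K _ ((a * b) ⊗ₜ[K] ⁅x, y⁆) (c ⊗ₜ[K] w)) +
      F (wedgeHom K _ ((b * c) ⊗ₜ[K] ⁅y, w⁆) (a ⊗ₜ[K] x)) +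
      F (wedgeHom K _ ((c * a) ⊗ₜ[K] ⁅w, x⁆) (b ⊗ₜ[K] y)) = 0 := by
  simp only [← LieAlgebra.ExtendScalars.bracket_tmul, ← map_add]
  exact hF _ (dd_mem_B2 K (a ⊗ₜ[K] x) (b ⊗ₜ[K] y) (c ⊗ₜ[K] w))

end Helpers

/-- Every 2-cocycle `f = f₁∘p₁ + f₂∘p₂ + f₃∘p₃` admits a decomposition
`f₁ = f₁⁰ + f₁¹` where `f₁⁰∘p₁` vanishes on `g × g'`, `f̃₁¹` has invariant values and
`f₁¹` vanishes on `T₀(A) ⊗ S²(k)`; moreover `f₁⁰∘p₁` and `f₁¹∘p₁ + f₂∘p₂ + f₃∘p₃` are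
2-cocycles. -/
theorem statement10
    (P : ↥(lambda2 K (A ⊗[K] k)) ≃ₗ[K] Wspace K A k) (hP : IsDecomposition K P)
    (f1 : M1 K A k →ₗ[K] z) (f2 : M2 K A k →ₗ[K] z) (f3 : M3 K A k →ₗ[K] z)
    (hf : IsCocycle K A k z (fun t => f1 (P t).1 + f2 (P t).2.1 + f3 (P t).2.2)) :
    ∃ f10 f11 : M1 K A k →ₗ[K] z,
      f1 = f10 + f11 ∧
      (∀ (a b : A) (x y : k), y ∈ derived K k →
        f10 (⟨wedge K A a b, wedge_mem K a b⟩ ⊗ₜ[K] ⟨vee K k x y, vee_mem K x y⟩) = 0) ∧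
      (∀ (a b : A) (x y w : k),
        f11 (⟨wedge K A a b, wedge_mem K a b⟩ ⊗ₜ[K] ⟨vee K k ⁅x, y⁆ w, vee_mem K _ _⟩) =
          f11 (⟨wedge K A a b, wedge_mem K a b⟩ ⊗ₜ[K] ⟨vee K k x ⁅y, w⁆, vee_mem K _ _⟩)) ∧
      (∀ t : ↥(lambda2 K A), (t : A ⊗[K] A) ∈ T0A K A → ∀ s : ↥(sym2 K k),
        f11 (t ⊗ₜ[K] s) = 0) ∧
      IsCocycle K A k z (fun t => f10 (P t).1) ∧
      IsCocycle K A k z (fun t => f11 (P t).1 + f2 (P t).2.1 + f3 (P t).2.2) := by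
  have hPw : ∀ (a b : A) (x y : k), P (wedgeHom K _ (a ⊗ₜ[K] x) (b ⊗ₜ[K] y)) =
      (wedgeHom K A a b ⊗ₜ[K] veeHom K k x y, (a * b) ⊗ₜ[K] wedgeHom K k x y,
        iaMk K a b ⊗ₜ[K] wedgeHom K k x y) := hP
  let q1 : lambda2 K (A ⊗[K] k) →ₗ[K] M1 K A k := LinearMap.fst K _ _ ∘ₗ P.toLinearMap
  let F : lambda2 K (A ⊗[K] k) →ₗ[K] z :=
    (f1.coprod (f2.coprod f3)) ∘ₗ P.toLinearMap
  have hFP : ∀ t, F t = f1 (P t).1 + f2 (P t).2.1 + f3 (P t).2.2 := fun t =>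
    (add_assoc _ _ _).symm
  have hF : IsCocycle K A k z F := fun t ht => (hFP t).trans (hf t ht)
  obtain ⟨hinv, hT0⟩ := invariant_and_T0_of_cocycle_identity K
    (fun a b x y => f1 (wedgeHom K A a b ⊗ₜ[K] veeHom K k x y))
    (fun a x y => f2 (a ⊗ₜ[K] wedgeHom K k x y))
    (fun a b x y => f3 (iaMk K a b ⊗ₜ[K] wedgeHom K k x y))
    (fun a b x y => by rw [wedgeHom_swap a b, TensorProduct.neg_tmul]; exact map_neg f1 _)
    (fun a b x y => by rw [veeHom_swap])
    (fun a b x y => by rw [iaMk_swap])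
    (fun a x y => by rw [iaMk_one_right, TensorProduct.zero_tmul, map_zero])
    (fun a b c x y w => by
      have := hF.identity a b c x y w
      simpa only [hFP, hPw] using this)
  let ev (s : sym2 K k) : lambda2 K A →ₗ[K] z := f1 ∘ₗ (TensorProduct.mk K _ _).flip s
  have hev : ∀ s t, ev s t = f1 (t ⊗ₜ[K] s) := fun _ _ => rfl
  have inv_all : ∀ (t : lambda2 K A) (x y w : k),
      f1 (t ⊗ₜ[K] veeHom K k ⁅x, y⁆ w) = f1 (t ⊗ₜ[K] veeHom K k x ⁅y, w⁆) := by
    intro t x y w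
    refine sub_eq_zero.mp (apply_eq_zero_of_mem_span
      (ev (veeHom K k ⁅x, y⁆ w) - ev (veeHom K k x ⁅y, w⁆)) _ ?_ t t.2)
    rintro _ ⟨a, b, rfl⟩
    exact ⟨wedge_mem K a b, sub_eq_zero.mpr (hinv a b x y w)⟩
  have T0_lie : ∀ t : lambda2 K A, (t : A ⊗[K] A) ∈ T0A K A → ∀ x y w : k,
      f1 (t ⊗ₜ[K] veeHom K k ⁅x, y⁆ w) = 0 := by
    intro t ht x y w
    refine apply_eq_zero_of_mem_span (ev (veeHom K k ⁅x, y⁆ w)) _ ?_ t ht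
    rintro _ ⟨a, b, c, rfl⟩
    refine ⟨T0A_el_mem_lambda2 K a b c, ?_⟩
    change ev _ (wedgeHom K A (a * b) c + wedgeHom K A (b * c) a + wedgeHom K A (c * a) b
      - wedgeHom K A (a * b * c) 1) = 0
    rw [map_sub, map_add, map_add]
    exact hT0 a b c x y w
  let T := (T0A K A).comap (lambda2 K A).subtype
  obtain ⟨e, he, heT⟩ : ∃ e : lambda2 K A →ₗ[K] lambda2 K A, (∀ t, e t ∈ T) ∧ ∀ t ∈ T, e t = t :=
    exists_linearProjection (V := lambda2 K A) T
  let f10 : M1 K A k →ₗ[K] z := f1 ∘ₗ e.rTensor (sym2 K k)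
  have h10 : ∀ t s, f10 (t ⊗ₜ[K] s) = f1 (e t ⊗ₜ[K] s) := fun _ _ => rfl
  have h11 : ∀ t s, (f1 - f10) (t ⊗ₜ[K] s) = f1 ((t - e t) ⊗ₜ[K] s) := fun t s => by
    rw [LinearMap.sub_apply, h10, TensorProduct.sub_tmul, map_sub]
  have h10_cocycle : IsCocycle K A k z (f10 ∘ₗ q1) := by
    refine isCocycle_of_apply_wedge_eq_zero fun a c x y w => ?_
    change f10 (P _).1 = 0
    rw [hPw, h10, T0_lie _ (he _)]
  refine ⟨f10, f1 - f10, (add_sub_cancel _ _).symm, ?_, ?_, ?_, h10_cocycle, ?_⟩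
  · intro a b x y hy
    change f10 (wedgeHom K A a b ⊗ₜ[K] veeHom K k x y) = 0
    refine (Submodule.span_le (p := LinearMap.ker
      (f10 ∘ₗ TensorProduct.mk K _ _ (wedgeHom K A a b) ∘ₗ veeHom K k x))).mpr ?_ hy
    rintro _ ⟨u, v, rfl⟩
    change f10 (wedgeHom K A a b ⊗ₜ[K] veeHom K k x ⁅u, v⁆) = 0
    rw [veeHom_swap, h10, T0_lie _ (he _)]
  · intro a b x y w
    exact (h11 _ _).trans ((inv_all _ x y w).trans (h11 _ _).symm)
  · intro t ht s
    rw [h11, heT t ht, sub_self, TensorProduct.zero_tmul, map_zero]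
  · intro t ht
    have h0 : f10 (P t).1 = 0 := h10_cocycle t ht
    have h1 := hf t ht
    simpa only [LinearMap.sub_apply, h0, sub_zero] using h1

end CurrentPaper
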